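/- arXiv:2006.09133 — 3 statements merged into one kernel-verified Lean document; each statement's English description precedes it below -/
import Mathlib

section
/- Fix constants $c>0$, $\rho>0$, $\beta_0\ge 1$ and $q\ge 1$. Then there exists a constant $C=C(q,\rho,c,\beta_0)$ such that for every $t\in(0,1]$ and every measurable random variable $X:\Omega\to(0,+\infty)$ on a probability space satisfying $\mathbb{E}\,[\mathrm{e}^{-\beta X}]\le \mathrm{e}^{-c\,t\,\beta^{\rho}}$ for all $\beta\ge\beta_0$, one has $\mathbb{E}\,[X^{-q}]\le C\, t^{-q/\rho}$. -/
open MeasureTheory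

open Set in
/-- The Gamma integral `∫₀^∞ x ^ (s - 1) exp (-b x ^ p) dx` as a lower Lebesgue integral. -/
theorem lintegral_rpow_mul_exp_neg_mul_rpow {p s b : ℝ} (hp : 0 < p) (hs : 0 < s) (hb : 0 < b) :
    ∫⁻ x in Ioi (0 : ℝ), ENNReal.ofReal (x ^ (s - 1) * Real.exp (-b * x ^ p)) =
      ENNReal.ofReal (b ^ (-(s / p)) * (1 / p) * Real.Gamma (s / p)) := by
  have h := integral_rpow_mul_exp_neg_mul_rpow hp (show -1 < s - 1 by linarith) hb
  rw [sub_add_cancel, neg_div] at h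
  have hpos : 0 < b ^ (-(s / p)) * (1 / p) * Real.Gamma (s / p) := by
    have := Real.Gamma_pos_of_pos (div_pos hs hp)
    positivity
  rw [← h, ofReal_integral_eq_lintegral_ofReal (.of_integral_ne_zero (h ▸ hpos.ne'))]
  filter_upwards [ae_restrict_mem measurableSet_Ioi] with x (hx : 0 < x)
  positivity

/-- The negative moments of a positive random variable are Mellin transforms of its Laplace
transform. -/
theorem ofReal_Gamma_mul_lintegral_rpow_neg {Ω : Type*} [MeasurableSpace Ω] {P : Measure Ω}
    [SFinite P] {X : Ω → ℝ} (hX : Measurable X) (hpos : ∀ ω, 0 < X ω) {q : ℝ} (hq : 0 < q) :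
    ENNReal.ofReal (Real.Gamma q) * ∫⁻ ω, ENNReal.ofReal (X ω ^ (-q)) ∂P =
      ∫⁻ β in Set.Ioi (0 : ℝ), ENNReal.ofReal (β ^ (q - 1)) *
        ∫⁻ ω, ENNReal.ofReal (Real.exp (-(β * X ω))) ∂P := by
  have key (ω : Ω) : ENNReal.ofReal (Real.Gamma q) * ENNReal.ofReal (X ω ^ (-q)) =
      ∫⁻ β in Set.Ioi (0 : ℝ),
        ENNReal.ofReal (β ^ (q - 1)) * ENNReal.ofReal (Real.exp (-(β * X ω))) := by
    have h := lintegral_rpow_mul_exp_neg_mul_rpow one_pos hq (hpos ω)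
    simp only [div_one, mul_one, Real.rpow_one] at h
    rw [← ENNReal.ofReal_mul (Real.Gamma_pos_of_pos hq).le, mul_comm (Real.Gamma q), ← h]
    refine setLIntegral_congr_fun measurableSet_Ioi fun β (hβ : 0 < β) ↦ ?_
    rw [← ENNReal.ofReal_mul (by positivity), neg_mul, mul_comm (X ω)]
  rw [← lintegral_const_mul _ (by fun_prop)]
  simp_rw [key]
  rw [lintegral_lintegral_swap (by fun_prop)]
  exact lintegral_congr fun β ↦ lintegral_const_mul _ (by fun_prop)

/-- Negative-moment bound from a stretched-exponential Laplace transform bound. -/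
theorem stmt_1 (c ρ β₀ q : ℝ) (hc : 0 < c) (hρ : 0 < ρ) (hβ₀ : 1 ≤ β₀) (hq : 1 ≤ q) :
    ∃ C : ℝ, 0 < C ∧
      ∀ (Ω : Type) [MeasurableSpace Ω] (P : Measure Ω) [IsProbabilityMeasure P]
        (X : Ω → ℝ), Measurable X → (∀ ω, 0 < X ω) →
        ∀ t : ℝ, t ∈ Set.Ioc (0 : ℝ) 1 →
          (∀ β : ℝ, β₀ ≤ β →
            (∫⁻ ω, ENNReal.ofReal (Real.exp (-(β * X ω))) ∂P) ≤
              ENNReal.ofReal (Real.exp (-(c * t * β ^ ρ)))) →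
          (∫⁻ ω, ENNReal.ofReal (X ω ^ (-q)) ∂P) ≤
            ENNReal.ofReal (C * t ^ (-(q / ρ))) := by
  have hq0 : 0 < q := by linarith
  have hΓ := Real.Gamma_pos_of_pos hq0
  have hΓ' := Real.Gamma_pos_of_pos (div_pos hq0 hρ)
  refine ⟨(Real.Gamma q)⁻¹ * (Real.exp (c * β₀ ^ ρ) *
    (c ^ (-(q / ρ)) * (1 / ρ) * Real.Gamma (q / ρ))), by positivity, ?_⟩
  intro Ω _ P _ X hX hpos t ⟨ht, ht1⟩ hL
  have hLaplace (β : ℝ) (hβ : 0 < β) :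
      ∫⁻ ω, ENNReal.ofReal (Real.exp (-(β * X ω))) ∂P ≤
        ENNReal.ofReal (Real.exp (c * β₀ ^ ρ) * Real.exp (-(c * t) * β ^ ρ)) := by
    rw [← Real.exp_add]
    rcases le_total β₀ β with h | h
    · refine (hL β h).trans (ENNReal.ofReal_le_ofReal (Real.exp_le_exp.2 ?_))
      have : 0 ≤ c * β₀ ^ ρ := by positivity
      linarith
    · calc ∫⁻ ω, ENNReal.ofReal (Real.exp (-(β * X ω))) ∂P ≤ ∫⁻ _, 1 ∂P := by
            refine lintegral_mono fun ω ↦ ENNReal.ofReal_le_one.2 (Real.exp_le_one_iff.2 ?_)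
            have := mul_pos hβ (hpos ω)
            linarith
        _ = 1 := by simp
        _ ≤ _ := by
            refine ENNReal.one_le_ofReal.2 (Real.one_le_exp ?_)
            have h1 : β ^ ρ ≤ β₀ ^ ρ := by gcongr
            have h2 : c * t * β ^ ρ ≤ c * 1 * β₀ ^ ρ := by gcongr
            linarith
  have hmain : ENNReal.ofReal (Real.Gamma q) * ∫⁻ ω, ENNReal.ofReal (X ω ^ (-q)) ∂P ≤
      ENNReal.ofReal (Real.exp (c * β₀ ^ ρ) *
        ((c * t) ^ (-(q / ρ)) * (1 / ρ) * Real.Gamma (q / ρ))) := by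
    rw [ofReal_Gamma_mul_lintegral_rpow_neg hX hpos hq0, ENNReal.ofReal_mul (by positivity),
      ← lintegral_rpow_mul_exp_neg_mul_rpow hρ hq0 (mul_pos hc ht),
      ← lintegral_const_mul _ (by fun_prop)]
    refine setLIntegral_mono' measurableSet_Ioi fun β (hβ : 0 < β) ↦ ?_
    calc _ ≤ _ := mul_le_mul_right (hLaplace β hβ) _
      _ = _ := by
        rw [← ENNReal.ofReal_mul (by positivity), ← ENNReal.ofReal_mul (by positivity),
          mul_left_comm]
  have hΓ0 : ENNReal.ofReal (Real.Gamma q) ≠ 0 := (ENNReal.ofReal_pos.2 hΓ).ne'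
  rw [← ENNReal.mul_le_mul_iff_right hΓ0 ENNReal.ofReal_ne_top]
  refine hmain.trans_eq ?_
  rw [← ENNReal.ofReal_mul hΓ.le, Real.mul_rpow hc.le ht.le]
  congr 1
  field_simp
end

section
/- Let $\nu$ be a measure on a measurable space $E$, let $h:E\to[0,+\infty)$ be measurable, and let $\rho>0$. Assume that $\liminf_{\varepsilon\downarrow 0}\,\varepsilon^{\rho}\,\nu(\{h\ge\varepsilon\})>0$ (the liminf being allowed to equal $+\infty$). Then there exist $c>0$ and $\beta_0\ge 1$ such that for all $\beta\ge\beta_0$, $\int_E\bigl(1-\mathrm{e}^{-\beta h(\xi)}\bigr)\,\nu(\mathrm{d}\xi)\;\ge\; c\,\beta^{\rho}$. -/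
open MeasureTheory Filter

/-- Markov's inequality for `1 - exp (-β h)` at the level `h = β⁻¹`. -/
theorem ofReal_one_sub_exp_neg_one_mul_measure_le_lintegral {E : Type*} [MeasurableSpace E]
    (ν : Measure E) {h : E → ℝ} (hmeas : Measurable h) {β : ℝ} (hβ : 0 < β) :
    ENNReal.ofReal (1 - Real.exp (-1)) * ν {x | β⁻¹ ≤ h x} ≤
      ∫⁻ x, ENNReal.ofReal (1 - Real.exp (-(β * h x))) ∂ν := by
  refine le_trans ?_ (mul_meas_ge_le_lintegral₀ (by fun_prop) (ENNReal.ofReal (1 - Real.exp (-1))))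
  gcongr with x
  intro hx
  have : 1 ≤ β * h x := (inv_le_iff_one_le_mul₀' hβ).mp hx
  gcongr

/-- The tail condition on a Lévy measure yields a polynomial lower bound
for the Laplace exponent. -/
theorem stmt_2 {E : Type*} [MeasurableSpace E] (ν : Measure E) (h : E → ℝ)
    (hmeas : Measurable h) (hnn : ∀ x, 0 ≤ h x) (ρ : ℝ) (hρ : 0 < ρ)
    (htail : 0 < Filter.liminf
      (fun ε : ℝ => ENNReal.ofReal (ε ^ ρ) * ν {x | ε ≤ h x})
      (nhdsWithin (0 : ℝ) (Set.Ioi 0))) :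
    ∃ c : ℝ, 0 < c ∧ ∃ β₀ : ℝ, 1 ≤ β₀ ∧ ∀ β : ℝ, β₀ ≤ β →
      ENNReal.ofReal (c * β ^ ρ) ≤
        ∫⁻ x, ENNReal.ofReal (1 - Real.exp (-(β * h x))) ∂ν := by
  obtain ⟨a, ha, hlt⟩ := ENNReal.lt_iff_exists_nnreal_btwn.mp htail
  have ha' : (0 : ℝ) < a := by exact_mod_cast ha
  obtain ⟨B, hB⟩ := eventually_atTop.mp
    (tendsto_inv_atTop_nhdsGT_zero.eventually (eventually_lt_of_lt_liminf hlt))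
  have hexp : 0 < 1 - Real.exp (-1) := by simp
  refine ⟨(1 - Real.exp (-1)) * a, by positivity, max 1 B, le_max_left _ _, fun β hβ => ?_⟩
  have hβ0 : 0 < β := zero_lt_one.trans_le ((le_max_left _ _).trans hβ)
  have hpow : 0 < β ^ ρ := Real.rpow_pos_of_pos hβ0 ρ
  calc ENNReal.ofReal ((1 - Real.exp (-1)) * a * β ^ ρ)
      = ENNReal.ofReal (1 - Real.exp (-1)) * (ENNReal.ofReal (β ^ ρ) * a) := by
        rw [mul_assoc, ENNReal.ofReal_mul hexp.le, ENNReal.ofReal_mul ha'.le,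
          ENNReal.ofReal_coe_nnreal, mul_comm (a : ENNReal)]
    _ ≤ ENNReal.ofReal (1 - Real.exp (-1)) *
          (ENNReal.ofReal (β ^ ρ) * (ENNReal.ofReal (β⁻¹ ^ ρ) * ν {x | β⁻¹ ≤ h x})) := by
        gcongr
        exact (hB β ((le_max_right _ _).trans hβ)).le
    _ = ENNReal.ofReal (1 - Real.exp (-1)) * ν {x | β⁻¹ ≤ h x} := by
        rw [← mul_assoc (ENNReal.ofReal (β ^ ρ)), ← ENNReal.ofReal_mul hpow.le,
          Real.inv_rpow hβ0.le, mul_inv_cancel₀ hpow.ne', ENNReal.ofReal_one, one_mul]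
    _ ≤ _ := ofReal_one_sub_exp_neg_one_mul_measure_le_lintegral ν hmeas hβ0
end

section
/- Let $\alpha\in(0,2)$, $\delta\in(0,1]$, $c>0$, $\kappa>1+\alpha/2$, and let $\rho:(-\delta,\delta)\setminus\{0\}\to(0,+\infty)$ be a $C^1$ function satisfying $\rho(\xi)\le c\,|\xi|^{-1-\alpha}$ and $\bigl|\rho'(\xi)/\rho(\xi)\bigr|\le c\,(|\xi|^{-1}+1)$ for all $\xi\in(-\delta,\delta)\setminus\{0\}$. Then there is a constant $C$ (depending only on $\alpha,c,\kappa$) such that for every $r\in(0,\delta)$, $\int_{-r}^{r}\Bigl[\,|\xi|^{2\kappa}\Bigl(\frac{\rho'(\xi)}{\rho(\xi)}\Bigr)^{2}+|\xi|^{2\kappa-2}\Bigr]\rho(\xi)\,\mathrm{d}\xi\;\le\;C\,r^{\,2\kappa-2-\alpha}$; in particular $\limsup_{r\downarrow 0}\,r^{-(2\kappa-2-\alpha)}\int_{-r}^{r}\bigl[|\xi|^{2\kappa}(\rho'/\rho)^{2}+|\xi|^{2\kappa-2}\bigr]\rho\,\mathrm{d}\xi<+\infty$. -/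
open MeasureTheory Filter

theorem setLIntegral_Ioo_abs_rpow {p r : ℝ} (hp : -1 < p) (hr : 0 < r) :
    ∫⁻ x in Set.Ioo (-r) r, ENNReal.ofReal (|x| ^ p) =
      ENNReal.ofReal (2 * (r ^ (p + 1) / (p + 1))) := by
  have hint : IntervalIntegrable (fun x : ℝ => x ^ p) volume 0 r :=
    intervalIntegral.intervalIntegrable_rpow' hp
  have hpos : ∫⁻ x in Set.Ioo 0 r, ENNReal.ofReal (|x| ^ p) =
      ENNReal.ofReal (r ^ (p + 1) / (p + 1)) := by
    have hval : ∫ x in (0 : ℝ)..r, x ^ p = r ^ (p + 1) / (p + 1) := by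
      rw [integral_rpow (Or.inl hp), Real.zero_rpow (by linarith), sub_zero]
    rw [← hval, intervalIntegral.integral_of_le hr.le, integral_Ioc_eq_integral_Ioo,
      ofReal_integral_eq_lintegral_ofReal]
    · refine setLIntegral_congr_fun measurableSet_Ioo fun x hx => ?_
      simp only [abs_of_pos hx.1]
    · exact ((intervalIntegrable_iff_integrableOn_Ioo_of_le hr.le).1 hint)
    · filter_upwards [ae_restrict_mem measurableSet_Ioo] with x hx
      exact Real.rpow_nonneg hx.1.le p
  have hneg : ∫⁻ x in Set.Ioo (-r) 0, ENNReal.ofReal (|x| ^ p) =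
      ∫⁻ x in Set.Ioo 0 r, ENNReal.ofReal (|x| ^ p) := by
    have h := (Measure.measurePreserving_neg (volume : Measure ℝ)).setLIntegral_comp_preimage_emb
      (MeasurableEquiv.neg ℝ).measurableEmbedding (fun x : ℝ => ENNReal.ofReal (|x| ^ p))
      (Set.Ioo 0 r)
    simpa using h
  have hnonneg : 0 ≤ r ^ (p + 1) / (p + 1) :=
    div_nonneg (Real.rpow_nonneg hr.le _) (by linarith)
  have hsplit : ∫⁻ x in Set.Ioo (-r) r, ENNReal.ofReal (|x| ^ p) =
      (∫⁻ x in Set.Ioo (-r) 0, ENNReal.ofReal (|x| ^ p)) +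
        ∫⁻ x in Set.Ioo 0 r, ENNReal.ofReal (|x| ^ p) := by
    rw [← Set.Ioo_union_Ico_eq_Ioo (neg_lt_zero.2 hr) hr.le,
      lintegral_union measurableSet_Ico
        (Set.disjoint_left.2 fun x hx hx' => not_lt_of_ge hx'.1 hx.2),
      setLIntegral_congr Ioo_ae_eq_Ico.symm]
  rw [hsplit, hneg, hpos, ← ENNReal.ofReal_add hnonneg hnonneg, two_mul]

theorem weighted_density_le {α c κ x d y : ℝ} (hx0 : x ≠ 0) (hx1 : |x| ≤ 1) (hc : 0 < c)
    (hy0 : 0 ≤ y) (hy : y ≤ c * |x| ^ (-1 - α)) (hd : |d| ≤ c * (|x|⁻¹ + 1)) :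
    |x| ^ (2 * κ) * d ^ 2 * y + |x| ^ (2 * κ - 2) * y ≤
      (4 * c ^ 3 + c) * |x| ^ (2 * κ - 3 - α) := by
  have hx : 0 < |x| := abs_pos.2 hx0
  have hinv : 1 ≤ |x|⁻¹ := (one_le_inv₀ hx).2 hx1
  have hd2 : d ^ 2 ≤ 4 * c ^ 2 * |x| ^ (-2 : ℝ) := by
    have h : |d| ≤ 2 * c * |x|⁻¹ := hd.trans (by nlinarith)
    calc d ^ 2 = |d| ^ 2 := (sq_abs d).symm
      _ ≤ (2 * c * |x|⁻¹) ^ 2 := by gcongr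
      _ = 4 * c ^ 2 * |x| ^ (-2 : ℝ) := by
        rw [Real.rpow_neg hx.le, Real.rpow_two]
        ring
  have e1 : |x| ^ (2 * κ) * |x| ^ (-2 : ℝ) = |x| ^ (2 * κ - 2) := by
    rw [← Real.rpow_add hx, ← sub_eq_add_neg]
  have e2 : |x| ^ (2 * κ - 2) * |x| ^ (-1 - α) = |x| ^ (2 * κ - 3 - α) := by
    rw [← Real.rpow_add hx]
    ring_nf
  calc |x| ^ (2 * κ) * d ^ 2 * y + |x| ^ (2 * κ - 2) * y
      ≤ |x| ^ (2 * κ) * (4 * c ^ 2 * |x| ^ (-2 : ℝ)) * y + |x| ^ (2 * κ - 2) * y := by gcongr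
    _ = (4 * c ^ 2 + 1) * |x| ^ (2 * κ - 2) * y := by rw [← e1]; ring
    _ ≤ (4 * c ^ 2 + 1) * |x| ^ (2 * κ - 2) * (c * |x| ^ (-1 - α)) := by gcongr
    _ = (4 * c ^ 3 + c) * |x| ^ (2 * κ - 3 - α) := by rw [← e2]; ring

/-- Small-ball growth condition (8.1) under the stable-comparability
condition (8.2): the truncated integrals over `(-r,r)` grow like
`r^(2κ-2-α)`, with a constant depending only on `α`, `c`, `κ`. -/
theorem stmt_9 (α c κ : ℝ) (hα0 : 0 < α) (hα2 : α < 2) (hc : 0 < c)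
    (hκ : 1 + α / 2 < κ) :
    ∃ C : ℝ, 0 < C ∧
      ∀ (δ : ℝ), 0 < δ → δ ≤ 1 →
        ∀ (ρf ρf' : ℝ → ℝ),
          (∀ ξ ∈ Set.Ioo (-δ) δ \ {0}, 0 < ρf ξ) →
          (∀ ξ ∈ Set.Ioo (-δ) δ \ {0}, HasDerivAt ρf (ρf' ξ) ξ) →
          ContinuousOn ρf' (Set.Ioo (-δ) δ \ {0}) →
          (∀ ξ ∈ Set.Ioo (-δ) δ \ {0}, ρf ξ ≤ c * |ξ| ^ (-1 - α)) →
          (∀ ξ ∈ Set.Ioo (-δ) δ \ {0}, |ρf' ξ / ρf ξ| ≤ c * (|ξ|⁻¹ + 1)) →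
          (∀ r : ℝ, 0 < r → r < δ →
            (∫⁻ ξ in Set.Ioo (-r) r,
                ENNReal.ofReal
                  (|ξ| ^ (2 * κ) * (ρf' ξ / ρf ξ) ^ 2 * ρf ξ +
                    |ξ| ^ (2 * κ - 2) * ρf ξ)) ≤
              ENNReal.ofReal (C * r ^ (2 * κ - 2 - α))) ∧
          Filter.limsup
              (fun r : ℝ =>
                ENNReal.ofReal (r ^ (-(2 * κ - 2 - α))) *
                  ∫⁻ ξ in Set.Ioo (-r) r,
                    ENNReal.ofReal
                      (|ξ| ^ (2 * κ) * (ρf' ξ / ρf ξ) ^ 2 * ρf ξ +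
                        |ξ| ^ (2 * κ - 2) * ρf ξ))
              (nhdsWithin (0 : ℝ) (Set.Ioi 0)) < ⊤ := by
  have hp : -1 < 2 * κ - 3 - α := by linarith
  have hq : 0 < 2 * κ - 2 - α := by linarith
  have hK : 0 < 4 * c ^ 3 + c := by positivity
  refine ⟨(4 * c ^ 3 + c) * (2 / (2 * κ - 2 - α)), by positivity, ?_⟩
  intro δ hδ0 hδ1 ρf ρf' hpos _ _ hρ hρ'
  rw [and_iff_left_of_imp]
  · intro r hr0 hrδ
    have hle : ∀ᵐ ξ ∂volume.restrict (Set.Ioo (-r) r),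
        ENNReal.ofReal (|ξ| ^ (2 * κ) * (ρf' ξ / ρf ξ) ^ 2 * ρf ξ +
            |ξ| ^ (2 * κ - 2) * ρf ξ) ≤
          ENNReal.ofReal (4 * c ^ 3 + c) * ENNReal.ofReal (|ξ| ^ (2 * κ - 3 - α)) := by
      filter_upwards [ae_restrict_mem measurableSet_Ioo,
        ae_restrict_of_ae (Measure.ae_ne volume (0 : ℝ))] with ξ hξ hξ0
      have hmem : ξ ∈ Set.Ioo (-δ) δ \ {0} :=
        ⟨⟨by linarith [hξ.1], by linarith [hξ.2]⟩, hξ0⟩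
      have hξ1 : |ξ| ≤ 1 := abs_le.2 ⟨by linarith [hξ.1], by linarith [hξ.2]⟩
      rw [← ENNReal.ofReal_mul hK.le]
      exact ENNReal.ofReal_le_ofReal
        (weighted_density_le hξ0 hξ1 hc (hpos ξ hmem).le (hρ ξ hmem) (hρ' ξ hmem))
    refine (lintegral_mono_ae hle).trans_eq ?_
    rw [lintegral_const_mul' _ _ ENNReal.ofReal_ne_top, setLIntegral_Ioo_abs_rpow hp hr0,
      ← ENNReal.ofReal_mul hK.le, show 2 * κ - 3 - α + 1 = 2 * κ - 2 - α by ring]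
    congr 1
    ring
  · intro hbound
    refine lt_of_le_of_lt (limsup_le_of_le (a := ENNReal.ofReal
      ((4 * c ^ 3 + c) * (2 / (2 * κ - 2 - α)))) (by isBoundedDefault) ?_) ENNReal.ofReal_lt_top
    filter_upwards [Ioo_mem_nhdsGT hδ0] with r hr
    refine (mul_le_mul_right (hbound r hr.1 hr.2) _).trans_eq ?_
    rw [← ENNReal.ofReal_mul (Real.rpow_nonneg hr.1.le _), mul_left_comm,
      ← Real.rpow_add hr.1, neg_add_cancel, Real.rpow_zero, mul_one]
end
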